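/- Let G be an arbitrary group and H a subgroup of infinite index in G. Then H is not quasidense in G, but its complement H^(c) = G ∖ H is quasidense in G (indeed G = H^(c) ∪ H^(c)y⁻¹ for any y ∈ G ∖ H). -/

import Mathlib

open Pointwise

/-- For subsets `B A` of a group `G`, `Prec B A` means `B ⪯ A`: there exist finitely many
elements `x₁, …, xₙ ∈ G` with `B ⊆ A x₁ ∪ ⋯ ∪ A xₙ`. -/
def Prec {G : Type*} [Group G] (B A : Set G) : Prop :=
  ∃ T : Finset G, B ⊆ A * (T : Set G)

/-- A subset `A` is quasidense if `G ⪯ A`. -/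
def Quasidense {G : Type*} [Group G] (A : Set G) : Prop :=
  Prec (Set.univ : Set G) A

/-- A quasidense subgroup has finite index. -/
theorem Quasidense.index_ne_zero {G : Type*} [Group G] {H : Subgroup G}
    (h : Quasidense (H : Set G)) : H.index ≠ 0 := by
  obtain ⟨T, hT⟩ := h
  have hsurj : Function.Surjective fun t : T => (QuotientGroup.mk (t : G)⁻¹ : G ⧸ H) := by
    intro q
    induction q using QuotientGroup.induction_on with
    | H g =>
      obtain ⟨a, ha, t, ht, hat⟩ := hT (Set.mem_univ g⁻¹)
      refine ⟨⟨t, ht⟩, QuotientGroup.eq.2 ?_⟩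
      have hg : g = t⁻¹ * a⁻¹ := by rw [← mul_inv_rev]; exact (inv_eq_iff_eq_inv.1 hat.symm)
      simpa [hg] using ha
  have : Finite (G ⧸ H) := Finite.of_surjective _ hsurj
  exact Subgroup.index_ne_zero_of_finite

/-- The complement of a subgroup and its right translate by `y⁻¹`, for `y` outside the subgroup,
cover the group. -/
theorem Subgroup.compl_union_image_mul_inv {G : Type*} [Group G] (H : Subgroup G) {y : G}
    (hy : y ∉ H) :
    (Set.univ : Set G) = (H : Set G)ᶜ ∪ (fun x => x * y⁻¹) '' (H : Set G)ᶜ := by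
  refine (Set.eq_univ_of_forall fun g => ?_).symm
  by_cases hg : g ∈ H
  · exact Or.inr ⟨g * y, fun h => hy ((H.mul_mem_cancel_left hg).1 h), mul_inv_cancel_right g y⟩
  · exact Or.inl hg

/-- Let `G` be an arbitrary group and `H` a subgroup of infinite index in `G`
(`H.index = 0` means `|G : H| = ∞`).  Then `H` is not quasidense in `G`, but its
complement `H^(c) = G ∖ H` is quasidense in `G`; indeed `G = H^(c) ∪ H^(c) y⁻¹`
for any `y ∈ G ∖ H`. -/
theorem complement_of_infinite_index_subgroup_quasidense {G : Type*} [Group G]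
    (H : Subgroup G) (hH : H.index = 0) :
    ¬ Quasidense (H : Set G) ∧ Quasidense ((H : Set G)ᶜ) ∧
      ∀ y : G, y ∉ H →
        (Set.univ : Set G) = (H : Set G)ᶜ ∪ (fun x => x * y⁻¹) '' (H : Set G)ᶜ := by
  refine ⟨fun h => h.index_ne_zero hH, ?_, fun y hy => H.compl_union_image_mul_inv hy⟩
  obtain ⟨y, hy⟩ : ∃ y, y ∉ H := by
    by_contra! h
    simp [(Subgroup.eq_top_iff' H).2 h] at hH
  classical
  refine ⟨{1, y⁻¹}, ?_⟩
  rw [H.compl_union_image_mul_inv hy]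
  rintro _ (hg | ⟨x, hx, rfl⟩)
  · exact ⟨_, hg, 1, by simp, mul_one _⟩
  · exact ⟨x, hx, y⁻¹, by simp, rfl⟩
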